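/- arXiv:2008.10804 — 4 statements merged into one kernel-verified Lean document; each statement's English description precedes it below -/
import Mathlib

section
/- Let A1, A2, B1, B2 be pairwise disjoint finite sets with |A1| ≥ |B1| ≥ 1 and |A2| ≥ |B2| ≥ 1, and let G1, G2, G3 and w be as in the combined setup. Let M1 be an optimal MCM for BOT(G1) with bottleneck edge e1 ∈ argmax_{e∈M1} w(e), let M2 be an optimal MCM for BOT(G2) with bottleneck edge e2 ∈ argmax_{e∈M2} w(e), and let e3 be a bottleneck edge of G3. Then w(e3) ≤ max{w(e1), w(e2)}. -/
/-- Edge set of the complete bipartite graph with parts `A` (agents) and `B` (tasks). -/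
def bipEdges {V : Type*} [DecidableEq V] (A B : Finset V) : Finset (Sym2 V) :=
  (A ×ˢ B).image (fun p => s(p.1, p.2))

/-- `M` is a matching in the graph with edge set `E`: a set of edges of `E` such that
no vertex is incident with more than one edge of `M`. -/
def IsMatching {V : Type*} (E M : Finset (Sym2 V)) : Prop :=
  M ⊆ E ∧ ∀ v : V, ∀ e₁ ∈ M, ∀ e₂ ∈ M, v ∈ e₁ → v ∈ e₂ → e₁ = e₂

/-- `M` is a maximum cardinality matching of the graph with edge set `E`. -/
def IsMCM {V : Type*} (E M : Finset (Sym2 V)) : Prop :=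
  IsMatching E M ∧ ∀ M' : Finset (Sym2 V), IsMatching E M' → M'.card ≤ M.card

/-- `e` attains the maximum weight among the edges of `M`, i.e. `e ∈ argmax_{e' ∈ M} w e'`. -/
def IsMaxEdge {V : Type*} (w : Sym2 V → ℝ) (M : Finset (Sym2 V)) (e : Sym2 V) : Prop :=
  e ∈ M ∧ ∀ e' ∈ M, w e' ≤ w e

/-- `M` is an optimal solution to the bottleneck assignment problem `BOT` on the graph with
edge set `E`: it is an MCM whose maximum edge weight is no larger than that of any MCM. -/
def IsOptMCM {V : Type*} (E : Finset (Sym2 V)) (w : Sym2 V → ℝ) (M : Finset (Sym2 V)) : Prop :=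
  IsMCM E M ∧ ∀ M' e e', IsMCM E M' → IsMaxEdge w M e → IsMaxEdge w M' e' → w e ≤ w e'

/-- `e` is a bottleneck edge: it attains the maximum weight in some optimal MCM. -/
def IsBottleneckEdge {V : Type*} (E : Finset (Sym2 V)) (w : Sym2 V → ℝ) (e : Sym2 V) : Prop :=
  ∃ M, IsOptMCM E w M ∧ IsMaxEdge w M e

/-- `P` is a path between `u` and `v` whose edges all lie in `E`: it is the set of consecutive
edges of a sequence of distinct vertices `u = v₁, v₂, …, v_{l+1} = v` (with `l ≥ 1`). -/
def IsPath {V : Type*} [DecidableEq V] (E P : Finset (Sym2 V)) (u v : V) : Prop :=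
  ∃ l : List V, l.Nodup ∧ 2 ≤ l.length ∧ l.head? = some u ∧ l.getLast? = some v ∧
    (∀ e ∈ List.zipWith (fun a b => s(a, b)) l l.tail, e ∈ E) ∧
    P = (List.zipWith (fun a b => s(a, b)) l l.tail).toFinset

/-- The alternation condition: every vertex is incident with at most one edge of `P ∩ M`
and at most one edge of `P \ M`. -/
def AltCond {V : Type*} [DecidableEq V] (M P : Finset (Sym2 V)) : Prop :=
  (∀ x : V, ∀ e₁ ∈ P ∩ M, ∀ e₂ ∈ P ∩ M, x ∈ e₁ → x ∈ e₂ → e₁ = e₂) ∧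
  (∀ x : V, ∀ e₁ ∈ P \ M, ∀ e₂ ∈ P \ M, x ∈ e₁ → x ∈ e₂ → e₁ = e₂)

/-- `P` is an alternating path relative to the matching `M`, between `u` and `v`, with all
edges in `E`. -/
def IsAltPath {V : Type*} [DecidableEq V] (E M P : Finset (Sym2 V)) (u v : V) : Prop :=
  IsPath E P u v ∧ AltCond M P

/-- `v` is a free vertex relative to the matching `M`. -/
def IsFree {V : Type*} (M : Finset (Sym2 V)) (v : V) : Prop :=
  ∀ e ∈ M, v ∉ e

/-- `P` is an augmenting path relative to the matching `M`, between the free vertices `u`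
and `v`, with all edges in `E`. -/
def IsAugPath {V : Type*} [DecidableEq V] (E M P : Finset (Sym2 V)) (u v : V) : Prop :=
  IsAltPath E M P u v ∧ IsFree M u ∧ IsFree M v

open Classical in
/-- `φ(G, M)`: the union of `M` with the set of edges of `E` of weight strictly smaller than
the largest weight of an edge of `M`. -/
noncomputable def phi {V : Type*} [DecidableEq V] (E : Finset (Sym2 V)) (w : Sym2 V → ℝ)
    (M : Finset (Sym2 V)) : Finset (Sym2 V) :=
  M ∪ E.filter (fun e => ∃ e', IsMaxEdge w M e' ∧ w e < w e')

/-- `e` is a critical bottleneck edge of the graph with edge set `E` relative to the matching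
`M`: it attains the maximum weight in `M` and `φ(G,M) \ {e}` contains no augmenting path
relative to `M \ {e}`. -/
def IsCritBotEdge {V : Type*} [DecidableEq V] (E : Finset (Sym2 V)) (w : Sym2 V → ℝ)
    (M : Finset (Sym2 V)) (e : Sym2 V) : Prop :=
  IsMaxEdge w M e ∧ ¬ ∃ P u v, IsAugPath (phi E w M \ {e}) (M \ {e}) P u v

/-- The complete bipartite graph on parts `A`, `B` is a bottleneck cluster relative to a
bottleneck edge with task endpoint `b`, for the optimal MCM `Mb`: every vertex is connected
to `b` by an alternating path contained in `φ(G, Mb)` relative to `Mb`. -/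
def IsBotCluster {V : Type*} [DecidableEq V] (A B : Finset V) (w : Sym2 V → ℝ)
    (Mb : Finset (Sym2 V)) (b : V) : Prop :=
  ∀ v ∈ A ∪ B, v ≠ b → ∃ P, IsAltPath (phi (bipEdges A B) w Mb) Mb P v b

/-- The graph with vertex set `Vs` and edge set `Es` is a tree: edges join vertices of `Vs`
and there is a unique path between any two distinct vertices. -/
def IsTreeOn {V : Type*} [DecidableEq V] (Vs : Finset V) (Es : Finset (Sym2 V)) : Prop :=
  (∀ e ∈ Es, ∀ x ∈ e, x ∈ Vs) ∧
  ∀ u ∈ Vs, ∀ v ∈ Vs, u ≠ v → ∃! P, IsPath Es P u v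

/-- The graph `(Vs, Es)` is an alternating tree relative to the matching `M`, rooted at `r`:
it is a tree and every path from the root `r` to another vertex is an alternating path
relative to `M`. -/
def IsAltTree {V : Type*} [DecidableEq V] (M : Finset (Sym2 V)) (r : V) (Vs : Finset V)
    (Es : Finset (Sym2 V)) : Prop :=
  r ∈ Vs ∧ IsTreeOn Vs Es ∧ ∀ v ∈ Vs, ∀ P, IsPath Es P r v → AltCond M P

theorem mem_bipEdges {V : Type*} [DecidableEq V] {A B : Finset V} {e : Sym2 V} :
    e ∈ bipEdges A B ↔ ∃ a ∈ A, ∃ b ∈ B, s(a, b) = e := by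
  simp only [bipEdges, Finset.mem_image, Finset.mem_product, Prod.exists]
  grind

theorem bipEdges_mono {V : Type*} [DecidableEq V] {A A' B B' : Finset V}
    (hA : A ⊆ A') (hB : B ⊆ B') : bipEdges A B ⊆ bipEdges A' B' :=
  Finset.image_subset_image (Finset.product_subset_product hA hB)

theorem mem_union_of_mem_bipEdges {V : Type*} [DecidableEq V] {A B : Finset V} {e : Sym2 V}
    (he : e ∈ bipEdges A B) {v : V} (hv : v ∈ e) : v ∈ A ∪ B := by
  obtain ⟨a, ha, b, hb, rfl⟩ := mem_bipEdges.1 he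
  rcases Sym2.mem_iff.1 hv with rfl | rfl
  · exact Finset.mem_union_left _ ha
  · exact Finset.mem_union_right _ hb

theorem IsMatching.card_le {V : Type*} [DecidableEq V] {A B : Finset V} {M : Finset (Sym2 V)}
    (hM : IsMatching (bipEdges A B) M) : M.card ≤ B.card := by
  have h : ∀ e : M, ∃ b ∈ B, b ∈ (e : Sym2 V) := fun e => by
    obtain ⟨a, _, b, hb, he⟩ := mem_bipEdges.1 (hM.1 e.2)
    exact ⟨b, hb, he ▸ Sym2.mem_mk_right a b⟩
  choose f hfB hf using h
  rw [← Finset.card_attach]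
  refine Finset.card_le_card_of_injOn f (fun e _ => hfB e) fun e _ e' _ hee' => ?_
  exact Subtype.ext (hM.2 (f e) e e.2 e' e'.2 (hf e) (hee' ▸ hf e'))

theorem exists_isMatching_card_eq {V : Type*} [DecidableEq V] {A B : Finset V}
    (hAB : Disjoint A B) (hcard : B.card ≤ A.card) :
    ∃ M, IsMatching (bipEdges A B) M ∧ M.card = B.card := by
  obtain ⟨f⟩ : Nonempty (B ↪ A) :=
    Function.Embedding.nonempty_of_card_le (by simpa using hcard)
  have hne : ∀ b b' : B, (f b : V) ≠ b' := fun b b' h =>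
    Finset.disjoint_left.1 hAB (f b).2 (h ▸ b'.2)
  refine ⟨B.attach.image fun b => s((f b : V), (b : V)), ⟨fun e he => ?_, ?_⟩, ?_⟩
  · obtain ⟨b, _, rfl⟩ := Finset.mem_image.1 he
    exact mem_bipEdges.2 ⟨f b, (f b).2, b, b.2, rfl⟩
  · intro v e he e' he' hv hv'
    obtain ⟨b, _, rfl⟩ := Finset.mem_image.1 he
    obtain ⟨b', _, rfl⟩ := Finset.mem_image.1 he'
    suffices b = b' by rw [this]
    rcases Sym2.mem_iff.1 hv with h | h <;> rcases Sym2.mem_iff.1 hv' with h' | h'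
    · exact f.injective (Subtype.ext (h.symm.trans h'))
    · exact absurd (h.symm.trans h') (hne b b')
    · exact absurd (h'.symm.trans h) (hne b' b)
    · exact Subtype.ext (h.symm.trans h')
  · rw [Finset.card_image_of_injective, Finset.card_attach]
    intro b b' h
    rcases Sym2.eq_iff.1 h with h | h
    · exact Subtype.ext h.2
    · exact absurd h.1 (hne b b')

theorem IsMCM.card_eq {V : Type*} [DecidableEq V] {A B : Finset V} {M : Finset (Sym2 V)}
    (hM : IsMCM (bipEdges A B) M) (hAB : Disjoint A B) (hcard : B.card ≤ A.card) :
    M.card = B.card := by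
  obtain ⟨N, hN, hNB⟩ := exists_isMatching_card_eq hAB hcard
  exact le_antisymm hM.1.card_le (hNB ▸ hM.2 N hN)

theorem IsMatching.union {V : Type*} [DecidableEq V] {A₁ A₂ B₁ B₂ : Finset V}
    {M₁ M₂ : Finset (Sym2 V)} (h₁ : IsMatching (bipEdges A₁ B₁) M₁)
    (h₂ : IsMatching (bipEdges A₂ B₂) M₂) (hd : Disjoint (A₁ ∪ B₁) (A₂ ∪ B₂)) :
    IsMatching (bipEdges (A₁ ∪ A₂) (B₁ ∪ B₂)) (M₁ ∪ M₂) := by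
  have key : ∀ v, ∀ e ∈ M₁, ∀ e' ∈ M₂, v ∈ e → v ∉ e' := fun v e he e' he' hv hv' =>
    Finset.disjoint_left.1 hd (mem_union_of_mem_bipEdges (h₁.1 he) hv)
      (mem_union_of_mem_bipEdges (h₂.1 he') hv')
  refine ⟨Finset.union_subset
    (h₁.1.trans (bipEdges_mono Finset.subset_union_left Finset.subset_union_left))
    (h₂.1.trans (bipEdges_mono Finset.subset_union_right Finset.subset_union_right)), ?_⟩
  intro v e he e' he' hv hv'
  rcases Finset.mem_union.1 he with he | he <;> rcases Finset.mem_union.1 he' with he' | he'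
  · exact h₁.2 v e he e' he' hv hv'
  · exact absurd hv' (key v e he e' he' hv)
  · exact absurd hv (key v e' he' e he hv')
  · exact h₂.2 v e he e' he' hv hv'

theorem disjoint_of_subset_bipEdges {V : Type*} [DecidableEq V] {A₁ A₂ B₁ B₂ : Finset V}
    {M₁ M₂ : Finset (Sym2 V)} (h₁ : M₁ ⊆ bipEdges A₁ B₁) (h₂ : M₂ ⊆ bipEdges A₂ B₂)
    (hd : Disjoint (A₁ ∪ B₁) (A₂ ∪ B₂)) : Disjoint M₁ M₂ := by
  refine Finset.disjoint_left.2 fun e he he' => ?_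
  obtain ⟨a, ha, b, _, rfl⟩ := mem_bipEdges.1 (h₁ he)
  exact Finset.disjoint_left.1 hd (Finset.mem_union_left _ ha)
    (mem_union_of_mem_bipEdges (h₂ he') (Sym2.mem_mk_left a b))

theorem IsMCM.union {V : Type*} [DecidableEq V] {A₁ A₂ B₁ B₂ : Finset V}
    {M₁ M₂ : Finset (Sym2 V)} (h₁ : IsMCM (bipEdges A₁ B₁) M₁)
    (h₂ : IsMCM (bipEdges A₂ B₂) M₂) (hd : Disjoint (A₁ ∪ B₁) (A₂ ∪ B₂))
    (hAB₁ : Disjoint A₁ B₁) (hAB₂ : Disjoint A₂ B₂)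
    (hcard₁ : B₁.card ≤ A₁.card) (hcard₂ : B₂.card ≤ A₂.card) :
    IsMCM (bipEdges (A₁ ∪ A₂) (B₁ ∪ B₂)) (M₁ ∪ M₂) := by
  refine ⟨h₁.1.union h₂.1 hd, fun M' hM' => ?_⟩
  rw [Finset.card_union_of_disjoint (disjoint_of_subset_bipEdges h₁.1.1 h₂.1.1 hd),
    h₁.card_eq hAB₁ hcard₁, h₂.card_eq hAB₂ hcard₂]
  exact hM'.card_le.trans (Finset.card_union_le _ _)


/-- **Theorem 1 (bound).** For pairwise disjoint finite sets `A1, A2, B1, B2` with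
`|A1| ≥ |B1| ≥ 1` and `|A2| ≥ |B2| ≥ 1`, if `M1` is an optimal MCM for `BOT(G1)` with
bottleneck edge `e1 ∈ argmax_{e ∈ M1} w e`, `M2` is an optimal MCM for `BOT(G2)` with
bottleneck edge `e2 ∈ argmax_{e ∈ M2} w e`, and `e3` is a bottleneck edge of the combined
graph `G3`, then `w e3 ≤ max (w e1) (w e2)`. -/
theorem bottleneck_bound {V : Type*} [DecidableEq V]
    (A1 A2 B1 B2 : Finset V)
    (hA1A2 : Disjoint A1 A2) (hA1B1 : Disjoint A1 B1) (hA1B2 : Disjoint A1 B2)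
    (hA2B1 : Disjoint A2 B1) (hA2B2 : Disjoint A2 B2) (hB1B2 : Disjoint B1 B2)
    (hB1 : 1 ≤ B1.card) (hA1 : B1.card ≤ A1.card)
    (hB2 : 1 ≤ B2.card) (hA2 : B2.card ≤ A2.card)
    (w : Sym2 V → ℝ) (M1 M2 : Finset (Sym2 V)) (e1 e2 e3 : Sym2 V)
    (hM1 : IsOptMCM (bipEdges A1 B1) w M1) (he1 : IsMaxEdge w M1 e1)
    (hM2 : IsOptMCM (bipEdges A2 B2) w M2) (he2 : IsMaxEdge w M2 e2)
    (he3 : IsBottleneckEdge (bipEdges (A1 ∪ A2) (B1 ∪ B2)) w e3) :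
    w e3 ≤ max (w e1) (w e2) := by
  have hd : Disjoint (A1 ∪ B1) (A2 ∪ B2) := by
    simp only [Finset.disjoint_union_left, Finset.disjoint_union_right]
    exact ⟨⟨hA1A2, hA2B1.symm⟩, hA1B2, hB1B2⟩
  have hU := hM1.1.union hM2.1 hd hA1B1 hA2B2 hA1 hA2
  obtain ⟨e, he, hmax⟩ := Finset.exists_max_image (M1 ∪ M2) w
    ⟨e1, Finset.mem_union_left _ he1.1⟩
  obtain ⟨M3, hM3, he3⟩ := he3
  refine (hM3.2 _ _ _ hU he3 ⟨he, hmax⟩).trans ?_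
  rcases Finset.mem_union.1 he with he | he
  · exact le_max_of_le_left (he1.2 e he)
  · exact le_max_of_le_right (he2.2 e he)
end

section
/- Let G = (A∪B, E) be a weighted complete bipartite graph, let M be a maximum cardinality matching of G, and let e_c be a critical bottleneck edge of G relative to M. Then M is an optimal MCM for BOT(G) and e_c is a bottleneck edge of G; in particular, w(e_c) equals the optimal value of BOT(G). -/
/-- The edges of a complete bipartite graph with disjoint parts are not loops. -/
theorem not_isDiag_of_mem_bipEdges {V : Type*} [DecidableEq V] {A B : Finset V}
    (hAB : Disjoint A B) {e : Sym2 V} (he : e ∈ bipEdges A B) : ¬ e.IsDiag := by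
  simp only [bipEdges, Finset.mem_image, Finset.mem_product] at he
  obtain ⟨⟨a, b⟩, ⟨ha, hb⟩, rfl⟩ := he
  rw [Sym2.mk_isDiag_iff]
  exact fun h => Finset.disjoint_left.mp hAB ha (h ▸ hb)

theorem IsMatching.subset {V : Type*} {E M N : Finset (Sym2 V)} (hM : IsMatching E M)
    (hNM : N ⊆ M) : IsMatching E N :=
  ⟨hNM.trans hM.1, fun v _ h₁ _ h₂ => hM.2 v _ (hNM h₁) _ (hNM h₂)⟩

/-- A loopless matching covers twice as many vertices as it has edges. -/
theorem IsMatching.card_biUnion_toFinset {V : Type*} [DecidableEq V] {E M : Finset (Sym2 V)}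
    (hE : ∀ e ∈ E, ¬ e.IsDiag) (hM : IsMatching E M) :
    (M.biUnion Sym2.toFinset).card = 2 * M.card := by
  rw [Finset.card_biUnion, Finset.sum_congr rfl fun e he =>
    Sym2.card_toFinset_of_not_isDiag e (hE e (hM.1 he)), Finset.sum_const, smul_eq_mul, mul_comm]
  intro e he f hf hef
  rw [Function.onFun, Finset.disjoint_left]
  intro v hv hv'
  exact hef (hM.2 v e he f hf (Sym2.mem_toFinset.mp hv) (Sym2.mem_toFinset.mp hv'))

/-- A larger matching covers some vertex that is free relative to a smaller one. -/
theorem IsMatching.exists_isFree_mem {V : Type*} [DecidableEq V] {E M N : Finset (Sym2 V)}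
    (hE : ∀ e ∈ E, ¬ e.IsDiag) (hN : IsMatching E N) (hM : IsMatching E M)
    (hcard : N.card < M.card) : ∃ a, IsFree N a ∧ ∃ e ∈ M, a ∈ e := by
  have hlt : (N.biUnion Sym2.toFinset).card < (M.biUnion Sym2.toFinset).card := by
    rw [hN.card_biUnion_toFinset hE, hM.card_biUnion_toFinset hE]
    omega
  obtain ⟨a, ha, haN⟩ := Finset.exists_mem_notMem_of_card_lt_card hlt
  simp only [Finset.mem_biUnion, Sym2.mem_toFinset, not_exists, not_and] at ha haN
  exact ⟨a, haN, ha⟩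

/-- Any vertex connected to a different vertex is incident with an edge. -/
theorem exists_mem_of_reachable_fromEdgeSet {V : Type*} {S : Set (Sym2 V)} {u v : V}
    (h : (SimpleGraph.fromEdgeSet S).Reachable u v) (huv : u ≠ v) : ∃ e ∈ S, u ∈ e := by
  obtain ⟨p⟩ := h
  cases p with
  | nil => exact absurd rfl huv
  | cons h _ => exact ⟨_, ((SimpleGraph.fromEdgeSet_adj S).mp h).1, Sym2.mem_mk_left _ _⟩

/-- If a matching `M` is larger than a matching `N`, then some two distinct vertices free relative
to `N` are connected within `N ∪ M`. -/
theorem IsMatching.exists_isFree_reachable {V : Type*} [DecidableEq V] {E M N : Finset (Sym2 V)}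
    (hE : ∀ e ∈ E, ¬ e.IsDiag) (hN : IsMatching E N) (hM : IsMatching E M)
    (hcard : N.card < M.card) :
    ∃ u v, u ≠ v ∧ IsFree N u ∧ IsFree N v ∧
      (SimpleGraph.fromEdgeSet (↑(N ∪ M) : Set (Sym2 V))).Reachable u v := by
  induction hn : M.card using Nat.strong_induction_on generalizing M N with
  | _ n ih =>
  subst hn
  obtain ⟨a, haN, e, heM, hae⟩ := hN.exists_isFree_mem hE hM hcard
  obtain ⟨b, rfl⟩ := hae
  have hab : a ≠ b := fun h => hE _ (hM.1 heM) (Sym2.mk_isDiag_iff.mpr h)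
  have hadj : (SimpleGraph.fromEdgeSet (↑(N ∪ M) : Set (Sym2 V))).Adj a b := by
    rw [SimpleGraph.fromEdgeSet_adj]
    exact ⟨Finset.mem_union_right _ heM, hab⟩
  by_cases hbN : IsFree N b
  · exact ⟨a, b, hab, haN, hbN, hadj.reachable⟩
  simp only [IsFree, not_forall, not_not] at hbN
  obtain ⟨f, hfN, hbf⟩ := hbN
  obtain ⟨c, rfl⟩ := hbf
  have hbc : b ≠ c := fun h => hE _ (hN.1 hfN) (Sym2.mk_isDiag_iff.mpr h)
  have hadj' : (SimpleGraph.fromEdgeSet (↑(N ∪ M) : Set (Sym2 V))).Adj b c := by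
    rw [SimpleGraph.fromEdgeSet_adj]
    exact ⟨Finset.mem_union_left _ hfN, hbc⟩
  have hcM := Finset.card_erase_add_one heM
  have hcN := Finset.card_erase_add_one hfN
  obtain ⟨u, v, huv, hu, hv, hr⟩ := ih (M.erase s(a, b)).card (by omega)
    (hN.subset (Finset.erase_subset s(b, c) N)) (hM.subset (Finset.erase_subset s(a, b) M))
    (by omega) rfl
  have hsub : N.erase s(b, c) ∪ M.erase s(a, b) ⊆ N ∪ M :=
    Finset.union_subset_union (Finset.erase_subset _ _) (Finset.erase_subset _ _)
  have hr' := hr.mono (SimpleGraph.fromEdgeSet_mono (Finset.coe_subset.mpr hsub))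
  have ha_isolated : ∀ e ∈ N.erase s(b, c) ∪ M.erase s(a, b), a ∉ e := by
    intro e he hae
    rcases Finset.mem_union.mp he with he | he
    · exact haN e (Finset.mem_of_mem_erase he) hae
    · exact Finset.ne_of_mem_erase he
        (hM.2 a _ (Finset.mem_of_mem_erase he) _ heM hae (Sym2.mem_mk_left _ _))
  have hb_isolated : ∀ e ∈ N.erase s(b, c) ∪ M.erase s(a, b), b ∉ e := by
    intro e he hbe
    rcases Finset.mem_union.mp he with he | he
    · exact Finset.ne_of_mem_erase he
        (hN.2 b _ (Finset.mem_of_mem_erase he) _ hfN hbe (Sym2.mem_mk_left _ _))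
    · exact Finset.ne_of_mem_erase he
        (hM.2 b _ (Finset.mem_of_mem_erase he) _ heM hbe (Sym2.mem_mk_right _ _))
  obtain ⟨eu, heu, hueu⟩ := exists_mem_of_reachable_fromEdgeSet hr huv
  obtain ⟨ev, hev, hvev⟩ := exists_mem_of_reachable_fromEdgeSet hr.symm huv.symm
  have hua : u ≠ a := fun h => ha_isolated eu heu (h ▸ hueu)
  have hub : u ≠ b := fun h => hb_isolated eu heu (h ▸ hueu)
  have hva : v ≠ a := fun h => ha_isolated ev hev (h ▸ hvev)
  have hvb : v ≠ b := fun h => hb_isolated ev hev (h ▸ hvev)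
  have hfree : ∀ x, IsFree (N.erase s(b, c)) x → x ≠ b → x ≠ c → IsFree N x := by
    intro x hx hxb hxc e he hxe
    by_cases h : e = s(b, c)
    · subst h
      rcases Sym2.mem_iff.mp hxe with h | h
      · exact hxb h
      · exact hxc h
    · exact hx e (Finset.mem_erase.mpr ⟨h, he⟩) hxe
  have hac := hadj.reachable.trans hadj'.reachable
  by_cases huc : u = c
  · subst huc
    exact ⟨a, v, hva.symm, haN, hfree v hv hvb huv.symm, hac.trans hr'⟩
  by_cases hvc : v = c
  · subst hvc
    exact ⟨a, u, hua.symm, haN, hfree u hu hub huc, hac.trans hr'.symm⟩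
  exact ⟨u, v, huv, hfree u hu hub huc, hfree v hv hvb hvc, hr'⟩

theorem zipWith_support_tail {V : Type*} {G : SimpleGraph V} {u v : V} (p : G.Walk u v) :
    List.zipWith (fun a b => s(a, b)) p.support p.support.tail = p.edges := by
  induction p with
  | nil => rfl
  | cons h p ih =>
    rw [SimpleGraph.Walk.edges_cons, ← ih, SimpleGraph.Walk.support_cons, List.tail_cons]
    nth_rewrite 2 [← SimpleGraph.Walk.cons_tail_support]
    rw [List.zipWith_cons_cons]

theorem exists_isPath_of_reachable {V : Type*} [DecidableEq V] {E : Finset (Sym2 V)} {u v : V}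
    (h : (SimpleGraph.fromEdgeSet (E : Set (Sym2 V))).Reachable u v) (huv : u ≠ v) :
    ∃ P ⊆ E, IsPath E P u v := by
  obtain ⟨p, hp⟩ := h.exists_isPath
  have hmem : ∀ e ∈ p.edges, e ∈ E := fun e he => by
    have := p.edges_subset_edgeSet he
    rw [SimpleGraph.edgeSet_fromEdgeSet] at this
    exact this.1
  refine ⟨p.edges.toFinset, fun e he => hmem e (List.mem_toFinset.mp he), p.support,
    hp.support_nodup, ?_, ?_, ?_, ?_, ?_⟩
  · rw [SimpleGraph.Walk.length_support]
    have : p.length ≠ 0 := fun h0 => huv (SimpleGraph.Walk.eq_of_length_eq_zero h0)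
    omega
  · rw [List.head?_eq_some_head p.support_ne_nil, SimpleGraph.Walk.head_support]
  · rw [List.getLast?_eq_some_getLast p.support_ne_nil, SimpleGraph.Walk.getLast_support]
  · rwa [zipWith_support_tail]
  · rw [zipWith_support_tail]

theorem IsPath.mono {V : Type*} [DecidableEq V] {E E' P : Finset (Sym2 V)} {u v : V}
    (h : IsPath E P u v) (hE : E ⊆ E') : IsPath E' P u v := by
  obtain ⟨l, h₁, h₂, h₃, h₄, h₅, h₆⟩ := h
  exact ⟨l, h₁, h₂, h₃, h₄, fun e he => hE (h₅ e he), h₆⟩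

/-- Berge's lemma: a matching `N` smaller than a matching `M` has an augmenting path in `N ∪ M`. -/
theorem IsMatching.exists_isAugPath {V : Type*} [DecidableEq V] {E M N : Finset (Sym2 V)}
    (hE : ∀ e ∈ E, ¬ e.IsDiag) (hN : IsMatching E N) (hM : IsMatching E M)
    (hcard : N.card < M.card) : ∃ P u v, IsAugPath (N ∪ M) N P u v := by
  obtain ⟨u, v, huv, hu, hv, hr⟩ := hN.exists_isFree_reachable hE hM hcard
  obtain ⟨P, hPE, hP⟩ := exists_isPath_of_reachable hr huv
  have hPM : P \ N ⊆ M := by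
    intro e he
    rw [Finset.mem_sdiff] at he
    exact (Finset.mem_union.mp (hPE he.1)).resolve_left he.2
  exact ⟨P, u, v, ⟨hP, (hN.subset Finset.inter_subset_right).2, (hM.subset hPM).2⟩, hu, hv⟩

/-- An MCM with a critical bottleneck edge is an optimal solution of the bottleneck assignment
problem. -/
theorem IsCritBotEdge.isOptMCM {V : Type*} [DecidableEq V] {E M : Finset (Sym2 V)}
    {w : Sym2 V → ℝ} {ec : Sym2 V} (hE : ∀ e ∈ E, ¬ e.IsDiag) (hM : IsMCM E M)
    (hc : IsCritBotEdge E w M ec) : IsOptMCM E w M := by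
  refine ⟨hM, fun M' e e' hM' he he' => ?_⟩
  by_contra! hlt
  have hlt_ec : ∀ f ∈ M', w f < w ec := fun f hf =>
    (he'.2 f hf).trans_lt (hlt.trans_le (hc.1.2 e he.1))
  have hcard : (M \ {ec}).card < M'.card :=
    (Finset.card_lt_card (Finset.sdiff_ssubset (Finset.singleton_subset_iff.mpr hc.1.1)
      (Finset.singleton_nonempty ec))).trans_le (hM'.2 M hM.1)
  obtain ⟨P, u, v, ⟨hP, halt⟩, hfree⟩ :=
    (hM.1.subset Finset.sdiff_subset).exists_isAugPath hE hM'.1 hcard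
  refine hc.2 ⟨P, u, v, ⟨hP.mono (Finset.union_subset ?_ fun f hf => ?_), halt⟩, hfree⟩
  · exact Finset.sdiff_subset_sdiff Finset.subset_union_left subset_rfl
  · classical
    rw [phi, Finset.mem_sdiff, Finset.mem_union, Finset.mem_filter]
    exact ⟨Or.inr ⟨hM'.1.1 hf, ec, hc.1, hlt_ec f hf⟩,
      fun h => (hlt_ec f hf).ne (congrArg w (Finset.mem_singleton.mp h))⟩

/-- **Corollary 1.** A critical bottleneck edge `e_c` of `G` relative to an MCM `M` is a
bottleneck edge of `G`; moreover `M` is an optimal MCM for `BOT(G)` and `w e_c` equals the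
optimal value of `BOT(G)`. -/
theorem critBotEdge_isBottleneckEdge {V : Type*} [DecidableEq V]
    (A B : Finset V) (hAB : Disjoint A B)
    (w : Sym2 V → ℝ) (M : Finset (Sym2 V)) (ec : Sym2 V)
    (hM : IsMCM (bipEdges A B) M)
    (hc : IsCritBotEdge (bipEdges A B) w M ec) :
    IsOptMCM (bipEdges A B) w M ∧ IsBottleneckEdge (bipEdges A B) w ec ∧
    ∀ Mo eo, IsOptMCM (bipEdges A B) w Mo → IsMaxEdge w Mo eo → w eo = w ec := by
  have hopt := hc.isOptMCM (fun _ => not_isDiag_of_mem_bipEdges hAB) hM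
  exact ⟨hopt, ⟨M, hopt, hc.1⟩, fun Mo eo hMo heo =>
    le_antisymm (hMo.2 M eo ec hM heo hc.1) (hopt.2 Mo ec eo hMo.1 hc.1 heo)⟩
end

section
/- Let G = (A∪B, E) be a weighted complete bipartite graph, let M_b be an optimal MCM for BOT(G), and let e_c = {a_c, b_c} ∈ M_b be a critical bottleneck edge of G relative to M_b. Then {e_c} is the unique alternating path relative to M_b contained in φ(G, M_b) between a_c and b_c; that is, every alternating path P ⊆ φ(G, M_b) relative to M_b between a_c and b_c satisfies P = {e_c}. -/
theorem mem_or_mem_of_mem_zipWith_sym2 {V : Type*} {l l' : List V} {e : Sym2 V} {x : V}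
    (he : e ∈ List.zipWith (fun a b => s(a, b)) l l') (hx : x ∈ e) : x ∈ l ∨ x ∈ l' := by
  induction l generalizing l' with
  | nil => simp at he
  | cons a t ih =>
    cases l' with
    | nil => simp at he
    | cons b t' =>
      rw [List.zipWith_cons_cons, List.mem_cons] at he
      rcases he with rfl | he
      · rcases Sym2.mem_iff.1 hx with rfl | rfl <;> simp
      · rcases ih he with h | h <;> simp [h]

/-- A path that uses the edge joining its two endpoints consists of that edge alone. -/
theorem IsPath.eq_singleton_of_mem {V : Type*} [DecidableEq V] {E P : Finset (Sym2 V)} {u v : V}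
    (hP : IsPath E P u v) (huv : s(u, v) ∈ P) : P = {s(u, v)} := by
  obtain ⟨l, hnd, hlen, hhead, hlast, -, rfl⟩ := hP
  match l with
  | [] | [_] => simp at hlen
  | x :: y :: r =>
    obtain rfl : x = u := by simpa using hhead
    have hx : x ∉ y :: r := (List.nodup_cons.1 hnd).1
    rw [List.mem_toFinset, List.tail_cons, List.zipWith_cons_cons, List.mem_cons] at huv
    rcases huv with h | h
    · obtain rfl : v = y := Sym2.congr_right.1 h
      cases r with
      | nil => simp
      | cons z r =>
        have hmem : v ∈ z :: r := List.mem_of_getLast? (by simpa using hlast)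
        exact absurd hmem (List.nodup_cons.1 (List.nodup_cons.1 hnd).2).1
    · rcases mem_or_mem_of_mem_zipWith_sym2 h (Sym2.mem_mk_left x v) with h | h
      · exact absurd h hx
      · exact absurd (List.mem_cons_of_mem y h) hx

theorem isPath_singleton {V : Type*} [DecidableEq V] {E : Finset (Sym2 V)} {u v : V}
    (huv : u ≠ v) (hE : s(u, v) ∈ E) : IsPath E {s(u, v)} u v :=
  ⟨[u, v], by simp [huv], by simp, by simp, by simp, by simpa using hE, by simp⟩

theorem IsPath.diff_singleton {V : Type*} [DecidableEq V] {E P : Finset (Sym2 V)} {u v : V}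
    {e : Sym2 V} (hP : IsPath E P u v) (he : e ∉ P) : IsPath (E \ {e}) P u v := by
  obtain ⟨l, hnd, hlen, hhead, hlast, hE, rfl⟩ := hP
  refine ⟨l, hnd, hlen, hhead, hlast, fun f hf => ?_, rfl⟩
  rw [Finset.mem_sdiff, Finset.mem_singleton]
  refine ⟨hE f hf, ?_⟩
  rintro rfl
  exact he (List.mem_toFinset.2 hf)

theorem AltCond.diff_singleton {V : Type*} [DecidableEq V] {M P : Finset (Sym2 V)}
    {e : Sym2 V} (hP : AltCond M P) (he : e ∉ P) : AltCond (M \ {e}) P := by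
  have hinter : P ∩ (M \ {e}) = P ∩ M := by grind
  have hdiff : P \ (M \ {e}) = P \ M := by grind
  rwa [AltCond, hinter, hdiff]

theorem IsMatching.isFree_diff_singleton {V : Type*} [DecidableEq V] {E M : Finset (Sym2 V)}
    (hM : IsMatching E M) {e : Sym2 V} {x : V} (he : e ∈ M) (hx : x ∈ e) :
    IsFree (M \ {e}) x := by
  intro f hf hxf
  rw [Finset.mem_sdiff, Finset.mem_singleton] at hf
  exact hf.2 (hM.2 x f hf.1 e he hxf hx)

theorem ne_of_mem_bipEdges {V : Type*} [DecidableEq V] {A B : Finset V} (hAB : Disjoint A B)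
    {u v : V} (h : s(u, v) ∈ bipEdges A B) : u ≠ v := by
  rintro rfl
  obtain ⟨⟨a, b⟩, hp, hab⟩ := Finset.mem_image.1 h
  rw [Finset.mem_product] at hp
  obtain ⟨rfl, rfl⟩ : a = u ∧ b = u := by simpa using hab
  exact Finset.disjoint_left.1 hAB hp.1 hp.2

/-- **Proposition 1.** Let `M_b` be an optimal MCM for `BOT(G)` and let
`e_c = {a_c, b_c} ∈ M_b` be a critical bottleneck edge of `G` relative to `M_b`. Then the
length-one path `{e_c}` is the unique alternating path in `φ(G, M_b)` relative to `M_b`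
between `a_c` and `b_c`. -/
theorem unique_altPath_of_critBotEdge {V : Type*} [DecidableEq V]
    (A B : Finset V) (hAB : Disjoint A B)
    (w : Sym2 V → ℝ) (Mb : Finset (Sym2 V)) (ac bc : V)
    (hMb : IsOptMCM (bipEdges A B) w Mb)
    (hmem : s(ac, bc) ∈ Mb)
    (hc : IsCritBotEdge (bipEdges A B) w Mb s(ac, bc)) :
    IsAltPath (phi (bipEdges A B) w Mb) Mb {s(ac, bc)} ac bc ∧
    ∀ P, IsAltPath (phi (bipEdges A B) w Mb) Mb P ac bc → P = {s(ac, bc)} := by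
  have hM : IsMatching (bipEdges A B) Mb := hMb.1.1
  refine ⟨⟨isPath_singleton (ne_of_mem_bipEdges hAB (hM.1 hmem))
    (Finset.mem_union_left _ hmem), by constructor <;> grind⟩, fun P hP => ?_⟩
  refine hP.1.eq_singleton_of_mem (by_contra fun he => hc.2 ⟨P, ac, bc, ?_⟩)
  exact ⟨⟨hP.1.diff_singleton he, hP.2.diff_singleton he⟩,
    hM.isFree_diff_singleton hmem (Sym2.mem_mk_left ac bc),
    hM.isFree_diff_singleton hmem (Sym2.mem_mk_right ac bc)⟩
end

section
/- Let G = (A∪B, E) be a weighted complete bipartite graph, let M be a maximum cardinality matching of G, and let e ∈ M be the unique element of argmax_{e'∈M} w(e'). If there exists an augmenting path P ⊆ φ(G,M)\{e} relative to the matching M\{e}, then there exists a maximum cardinality matching M' of G with max_{e'∈M'} w(e') < w(e); in particular, the optimal value of BOT(G) is strictly less than w(e). -/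
section AugmentingPaths

variable {V : Type*}

/-- The list of consecutive edges of a sequence of vertices. -/
def pathEdges (l : List V) : List (Sym2 V) :=
  List.zipWith (fun a b => s(a, b)) l l.tail

lemma pathEdges_cons_cons (a b : V) (l : List V) :
    pathEdges (a :: b :: l) = s(a, b) :: pathEdges (b :: l) := rfl

lemma pathEdges_singleton (a : V) : pathEdges [a] = [] := rfl

lemma mem_of_mem_pathEdges {x : V} {f : Sym2 V} :
    ∀ {l : List V}, f ∈ pathEdges l → x ∈ f → x ∈ l
  | [], hf, _ => by simp [pathEdges] at hf
  | [a], hf, _ => by simp [pathEdges] at hf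
  | a :: b :: l, hf, hx => by
    rw [pathEdges_cons_cons, List.mem_cons] at hf
    rcases hf with rfl | hf
    · rcases Sym2.mem_iff.1 hx with rfl | rfl <;> simp
    · exact List.mem_cons_of_mem _ (mem_of_mem_pathEdges hf hx)

lemma head_edge_notMem_pathEdges {a b : V} {l : List V} (h : (a :: b :: l).Nodup) :
    s(a, b) ∉ pathEdges (b :: l) := fun hmem =>
  (List.nodup_cons.1 h).1 (mem_of_mem_pathEdges hmem (Sym2.mem_mk_left a b))

/-- An interior vertex of a path is incident with two distinct edges of the path. -/
lemma exists_two_pathEdges_of_interior {y u v : V} :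
    ∀ {l : List V}, l.Nodup → l.head? = some u → l.getLast? = some v → y ∈ l → y ≠ u → y ≠ v →
      ∃ e₁ ∈ pathEdges l, ∃ e₂ ∈ pathEdges l, y ∈ e₁ ∧ y ∈ e₂ ∧ e₁ ≠ e₂
  | [], _, _, _, hy, _, _ => by simp at hy
  | [a], _, hu, _, hy, hyu, _ => by simp_all
  | [a, b], _, hu, hv, hy, hyu, hyv => by simp_all
  | a :: b :: c :: l, hnd, hu, hv, hy, hyu, hyv => by
    by_cases hyb : y = b
    · subst hyb
      refine ⟨s(a, y), by simp [pathEdges_cons_cons], s(y, c), by simp [pathEdges_cons_cons],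
        by simp, by simp, fun h => ?_⟩
      exact head_edge_notMem_pathEdges hnd (by simp [pathEdges_cons_cons, h])
    · have hya : y ≠ a := by
        rintro rfl
        exact hyu (by simpa using hu)
      obtain ⟨e₁, h₁, e₂, h₂, h⟩ := exists_two_pathEdges_of_interior (y := y) (u := b) (v := v)
        (List.nodup_cons.1 hnd).2 rfl (by simpa using hv)
        ((List.mem_cons.1 hy).resolve_left hya) hyb hyv
      exact ⟨e₁, List.mem_cons_of_mem _ h₁, e₂, List.mem_cons_of_mem _ h₂, h⟩

variable [DecidableEq V]

/-- Along a path which alternates relative to `M` and ends in a free vertex, the edges outside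
`M` outnumber those in `M` by one if the first edge lies outside `M`, and by zero otherwise. -/
lemma card_pathEdges_sdiff {M : Finset (Sym2 V)} {v : V} (hv : IsFree M v) :
    ∀ (l : List V) (a b : V), (a :: b :: l).Nodup → (a :: b :: l).getLast? = some v →
      (∀ x, ∀ e₁ ∈ pathEdges (a :: b :: l), ∀ e₂ ∈ pathEdges (a :: b :: l), x ∈ e₁ → x ∈ e₂ →
        (e₁ ∈ M ↔ e₂ ∈ M) → e₁ = e₂) →
      ((pathEdges (a :: b :: l)).toFinset \ M).card =
        ((pathEdges (a :: b :: l)).toFinset ∩ M).card + if s(a, b) ∈ M then 0 else 1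
  | [], a, b, _, hl, _ => by
    have hb : b = v := by simpa using hl
    have hab : s(a, b) ∉ M := fun h => hv _ h (by simp [hb])
    rw [pathEdges_cons_cons, pathEdges_singleton, List.toFinset_cons, List.toFinset_nil,
      Finset.insert_sdiff_of_notMem _ hab, Finset.insert_inter_of_notMem hab]
    simp [hab]
  | c :: l, a, b, hnd, hl, halt => by
    have ih := card_pathEdges_sdiff hv l b c (List.nodup_cons.1 hnd).2 (by simpa using hl)
      fun x e₁ h₁ e₂ h₂ => halt x e₁ (List.mem_cons_of_mem _ h₁) e₂ (List.mem_cons_of_mem _ h₂)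
    have hnot := head_edge_notMem_pathEdges hnd
    have hne : ¬ (s(a, b) ∈ M ↔ s(b, c) ∈ M) := fun h => by
      have := halt b s(a, b) (by simp [pathEdges_cons_cons]) s(b, c)
        (by simp [pathEdges_cons_cons]) (by simp) (by simp) h
      exact hnot (by simp [pathEdges_cons_cons, this])
    rw [pathEdges_cons_cons a b, List.toFinset_cons]
    have hnot' : s(a, b) ∉ (pathEdges (b :: c :: l)).toFinset := by simpa using hnot
    by_cases hab : s(a, b) ∈ M
    · have hbc : s(b, c) ∉ M := by tauto
      rw [Finset.insert_sdiff_of_mem _ hab, Finset.insert_inter_of_mem hab,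
        Finset.card_insert_of_notMem (by simp [hnot]), ih]
      simp [hab, hbc]
    · have hbc : s(b, c) ∈ M := by tauto
      rw [Finset.insert_sdiff_of_notMem _ hab, Finset.insert_inter_of_notMem hab,
        Finset.card_insert_of_notMem (by simp [hnot]), ih]
      simp [hab, hbc]

/-- In an alternating path, edges sharing a vertex and lying on the same side of `M` agree. -/
lemma AltCond.eq_of_mem_iff {M P : Finset (Sym2 V)} (h : AltCond M P) {x : V} {e₁ e₂ : Sym2 V}
    (h₁ : e₁ ∈ P) (h₂ : e₂ ∈ P) (hx₁ : x ∈ e₁) (hx₂ : x ∈ e₂) (hiff : e₁ ∈ M ↔ e₂ ∈ M) :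
    e₁ = e₂ := by
  by_cases hm : e₁ ∈ M
  · exact h.1 x e₁ (Finset.mem_inter.2 ⟨h₁, hm⟩) e₂ (Finset.mem_inter.2 ⟨h₂, hiff.1 hm⟩) hx₁ hx₂
  · exact h.2 x e₁ (Finset.mem_sdiff.2 ⟨h₁, hm⟩) e₂
      (Finset.mem_sdiff.2 ⟨h₂, fun h => hm (hiff.2 h)⟩) hx₁ hx₂

lemma IsAugPath.subset {E M P : Finset (Sym2 V)} {u v : V} (h : IsAugPath E M P u v) : P ⊆ E := by
  obtain ⟨⟨⟨l, -, -, -, -, hE, rfl⟩, -⟩, -⟩ := h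
  exact fun f hf => hE f (List.mem_toFinset.1 hf)

lemma IsAugPath.card_sdiff {E M P : Finset (Sym2 V)} {u v : V} (h : IsAugPath E M P u v) :
    (P \ M).card = (P ∩ M).card + 1 := by
  obtain ⟨⟨⟨l, hnd, hlen, hu, hv, -, hP⟩, halt⟩, hfu, hfv⟩ := h
  change P = (pathEdges l).toFinset at hP
  match l with
  | [] => simp at hlen
  | [_] => simp at hlen
  | a :: b :: l =>
    have hau : a = u := by simpa using hu
    have hab : s(a, b) ∉ M := fun h => hfu _ h (by simp [hau])
    rw [hP, card_pathEdges_sdiff hfv l a b hnd hv fun x e₁ h₁ e₂ h₂ hx₁ hx₂ hiff =>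
      halt.eq_of_mem_iff (by simpa [hP] using h₁) (by simpa [hP] using h₂) hx₁ hx₂ hiff,
      if_neg hab]

/-- A matching edge off an augmenting path shares no vertex with the edges of the path. -/
lemma IsAugPath.notMem_of_mem {E F M P : Finset (Sym2 V)} {u v x : V} (h : IsAugPath E M P u v)
    (hM : IsMatching F M) {f g : Sym2 V} (hf : f ∈ M) (hfP : f ∉ P) (hg : g ∈ P) (hxf : x ∈ f) :
    x ∉ g := by
  intro hxg
  obtain ⟨⟨⟨l, hnd, -, hu, hv, -, hP⟩, halt⟩, hfu, hfv⟩ := h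
  change P = (pathEdges l).toFinset at hP
  have hmem : ∀ {e'}, e' ∈ P ↔ e' ∈ pathEdges l := by simp [hP]
  obtain ⟨e₁, h₁, e₂, h₂, hx₁, hx₂, hne⟩ := exists_two_pathEdges_of_interior hnd hu hv
    (mem_of_mem_pathEdges (hmem.1 hg) hxg) (fun h => hfu f hf (h ▸ hxf))
    (fun h => hfv f hf (h ▸ hxf))
  rw [← hmem] at h₁ h₂
  have off : ∀ e' ∈ P, x ∈ e' → e' ∉ M := fun e' he' hx he'M =>
    hfP (hM.2 x e' he'M f hf hx hxf ▸ he')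
  exact hne (halt.eq_of_mem_iff h₁ h₂ hx₁ hx₂ (by simp [off _ h₁ hx₁, off _ h₂ hx₂]))

/-- Augmenting a matching along an augmenting path gives a matching. -/
lemma IsAugPath.isMatching_augment {E F M P : Finset (Sym2 V)} {u v : V}
    (h : IsAugPath E M P u v) (hM : IsMatching F M) (hEF : E ⊆ F) :
    IsMatching F (M \ P ∪ P \ M) := by
  refine ⟨Finset.union_subset (Finset.sdiff_subset.trans hM.1)
    (Finset.sdiff_subset.trans (h.subset.trans hEF)), fun x e₁ h₁ e₂ h₂ hx₁ hx₂ => ?_⟩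
  simp only [Finset.mem_union, Finset.mem_sdiff] at h₁ h₂
  rcases h₁ with ⟨h₁, h₁'⟩ | ⟨h₁, h₁'⟩ <;> rcases h₂ with ⟨h₂, h₂'⟩ | ⟨h₂, h₂'⟩
  · exact hM.2 x e₁ h₁ e₂ h₂ hx₁ hx₂
  · exact absurd hx₂ (h.notMem_of_mem hM h₁ h₁' h₂ hx₁)
  · exact absurd hx₁ (h.notMem_of_mem hM h₂ h₂' h₁ hx₂)
  · exact h.1.2.eq_of_mem_iff h₁ h₂ hx₁ hx₂ (by simp [*])

/-- Augmenting along an augmenting path increases the cardinality by one. -/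
lemma IsAugPath.card_augment {E M P : Finset (Sym2 V)} {u v : V} (h : IsAugPath E M P u v) :
    (M \ P ∪ P \ M).card = M.card + 1 := by
  rw [Finset.card_union_of_disjoint disjoint_sdiff_sdiff, h.card_sdiff, ← add_assoc,
    Finset.inter_comm, Finset.card_sdiff_add_card_inter]

lemma phi_subset {E M : Finset (Sym2 V)} (w : Sym2 V → ℝ) (hM : M ⊆ E) : phi E w M ⊆ E := by
  classical
  exact Finset.union_subset hM (Finset.filter_subset _ _)

/-- If `e` is the unique heaviest edge of `M`, all other edges of `phi E w M` are lighter. -/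
lemma lt_of_mem_phi_sdiff {E M : Finset (Sym2 V)} {w : Sym2 V → ℝ} {e f : Sym2 V}
    (he : IsMaxEdge w M e) (huniq : ∀ e', IsMaxEdge w M e' → e' = e)
    (hf : f ∈ phi E w M \ {e}) : w f < w e := by
  simp only [phi, Finset.mem_sdiff, Finset.mem_union, Finset.mem_filter,
    Finset.mem_singleton] at hf
  obtain ⟨hf | ⟨-, e', he', hlt⟩, hne⟩ := hf
  · refine lt_of_le_of_ne (he.2 f hf) fun heq => hne (huniq f ⟨hf, fun e' he' => ?_⟩)
    exact heq ▸ he.2 e' he'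
  · exact huniq e' he' ▸ hlt

end AugmentingPaths

/-- If `M` is an MCM of `G` and `e ∈ M` is the unique element of `argmax_{e' ∈ M} w e'`, and
there exists an augmenting path `P ⊆ φ(G,M) \ {e}` relative to `M \ {e}`, then there exists
an MCM `M'` of `G` all of whose edges have weight strictly less than `w e`; in particular
the optimal value of `BOT(G)` is strictly less than `w e`. -/
theorem strict_improvement_of_augPath {V : Type*} [DecidableEq V]
    (A B : Finset V) (hAB : Disjoint A B)
    (w : Sym2 V → ℝ) (M : Finset (Sym2 V)) (e : Sym2 V)
    (hM : IsMCM (bipEdges A B) M)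
    (he : IsMaxEdge w M e)
    (huniq : ∀ e', IsMaxEdge w M e' → e' = e)
    (haug : ∃ P u v, IsAugPath (phi (bipEdges A B) w M \ {e}) (M \ {e}) P u v) :
    (∃ M', IsMCM (bipEdges A B) M' ∧ ∀ e' ∈ M', w e' < w e) ∧
    ∀ Mo eo, IsOptMCM (bipEdges A B) w Mo → IsMaxEdge w Mo eo → w eo < w e := by
  obtain ⟨P, u, v, hP⟩ := haug
  have hM₁ : IsMatching (bipEdges A B) (M \ {e}) :=
    ⟨Finset.sdiff_subset.trans hM.1.1, fun x e₁ h₁ e₂ h₂ =>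
      hM.1.2 x e₁ (Finset.mem_sdiff.1 h₁).1 e₂ (Finset.mem_sdiff.1 h₂).1⟩
  have hcard : ((M \ {e}) \ P ∪ P \ (M \ {e})).card = M.card := by
    rw [hP.card_augment, Finset.sdiff_singleton_eq_erase, Finset.card_erase_add_one he.1]
  have key : ∃ M', IsMCM (bipEdges A B) M' ∧ M'.Nonempty ∧ ∀ e' ∈ M', w e' < w e := by
    refine ⟨_, ⟨hP.isMatching_augment hM₁
      (Finset.sdiff_subset.trans (phi_subset w hM.1.1)), ?_⟩, ?_, fun f hf => ?_⟩
    · rw [hcard]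
      exact hM.2
    · rw [← Finset.card_pos, hcard]
      exact Finset.card_pos.2 ⟨e, he.1⟩
    · refine lt_of_mem_phi_sdiff (E := bipEdges A B) he huniq ?_
      rcases Finset.mem_union.1 hf with hf | hf
      · exact Finset.sdiff_subset_sdiff Finset.subset_union_left le_rfl (Finset.mem_sdiff.1 hf).1
      · exact hP.subset (Finset.mem_sdiff.1 hf).1
  obtain ⟨M', hM', hne, hlt⟩ := key
  refine ⟨⟨M', hM', hlt⟩, fun Mo eo hMo heo => ?_⟩
  obtain ⟨e', he', hmax⟩ := M'.exists_max_image w hne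
  exact (hMo.2 M' eo e' hM' heo ⟨he', hmax⟩).trans_lt (hlt e' he')
end
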